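/- Let H be a real Hilbert space, V : H →L[ℝ] H a compact, self-adjoint, positive continuous linear operator, β ∈ H, and α ∈ (0,1). Suppose w* ∈ H is a unit vector with T_α(w*) > 0 such that T_α(w) < T_α(w*) for every unit vector w with w ≠ w* and w ≠ −w* (uniqueness of the maximizer up to sign, condition (C1) of the paper). Let (T̂ₙ) be a sequence of functions T̂ₙ : H → ℝ such that sup_{‖w‖ ≤ 1} |T̂ₙ(w) − T_α(w)| → 0 as n → ∞, and let (ŵₙ) be unit vectors such that T̂ₙ(w) ≤ T̂ₙ(ŵₙ) for every unit vector w. Then min(‖ŵₙ − w*‖, ‖ŵₙ + w*‖) → 0 as n → ∞. (Deterministic core of the paper's Theorem 1: consistency of the empirical functional continuum basis functions.) -/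

import Mathlib

open RealInnerProductSpace Filter

/-- The continuum criterion `T_α(w) = ⟪β, V w⟫² ⋅ ⟪w, V w⟫^{α/(1-α) - 1}` when
`⟪w, V w⟫ > 0`, and `0` otherwise. -/
noncomputable def Tcrit {H : Type*} [NormedAddCommGroup H] [InnerProductSpace ℝ H]
    (V : H →L[ℝ] H) (β : H) (α : ℝ) (w : H) : ℝ :=
  if 0 < ⟪w, V w⟫ then ⟪β, V w⟫ ^ 2 * ⟪w, V w⟫ ^ (α / (1 - α) - 1) else 0

open scoped Topology

section WeakLimits

variable {ι H : Type*} [NormedAddCommGroup H] [InnerProductSpace ℝ H]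

/-- Bounded families in a Hilbert space converge weakly along ultrafilters. -/
theorem exists_weak_limit_of_norm_le [CompleteSpace H] (U : Ultrafilter ι) {u : ι → H} {r : ℝ}
    (hu : ∀ i, ‖u i‖ ≤ r) :
    ∃ w : H, ‖w‖ ≤ r ∧ ∀ x, Tendsto (fun i => ⟪u i, x⟫) U (𝓝 ⟪w, x⟫) := by
  let φ : ι → WeakDual ℝ H := fun i =>
    StrongDual.toWeakDual (InnerProductSpace.toDual ℝ H (u i))
  obtain ⟨f, hf, hlim⟩ := (WeakDual.isCompact_closedBall (𝕜 := ℝ) (E := H) 0 r).ultrafilter_le_nhds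
    (U.map φ) (le_principal_iff.2 <| mem_map.2 <| Eventually.of_forall fun i => by
      simpa [φ] using hu i)
  refine ⟨(InnerProductSpace.toDual ℝ H).symm (WeakDual.toStrongDual f), by simpa using hf,
    fun x => ?_⟩
  rw [InnerProductSpace.toDual_symm_apply]
  exact (WeakDual.eval_continuous x).continuousAt.tendsto.comp (show Tendsto φ U (𝓝 f) from hlim)

/-- A compact symmetric operator maps weak limits along ultrafilters to norm limits. -/
theorem IsCompactOperator.tendsto_of_tendsto_inner {V : H →L[ℝ] H}
    (hcpt : IsCompactOperator V) (hsa : ∀ x y : H, ⟪V x, y⟫ = ⟪x, V y⟫) {U : Ultrafilter ι}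
    {u : ι → H} {r : ℝ} (hu : ∀ i, ‖u i‖ ≤ r) {w : H}
    (hw : ∀ x, Tendsto (fun i => ⟪u i, x⟫) U (𝓝 ⟪w, x⟫)) :
    Tendsto (fun i => V (u i)) U (𝓝 (V w)) := by
  obtain ⟨K, hK, hKsub⟩ := hcpt.image_closedBall_subset_compact (f := V.toLinearMap) r
  obtain ⟨y, -, hy⟩ := hK.ultrafilter_le_nhds (U.map fun i => V (u i))
    (le_principal_iff.2 <| mem_map.2 <| Eventually.of_forall fun i =>
      hKsub ⟨u i, by simpa using hu i, rfl⟩)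
  replace hy : Tendsto (fun i => V (u i)) U (𝓝 y) := hy
  suffices y = V w by rwa [← this]
  refine ext_inner_right ℝ fun x => ?_
  refine tendsto_nhds_unique (hy.inner tendsto_const_nhds) ?_
  simpa only [hsa] using hw (V x)

/-- Weak convergence together with convergence of norms gives norm convergence. -/
theorem tendsto_of_tendsto_inner_of_tendsto_norm {l : Filter ι} {u : ι → H} {w : H}
    (hw : Tendsto (fun i => ⟪u i, w⟫) l (𝓝 ⟪w, w⟫))
    (hnorm : Tendsto (fun i => ‖u i‖) l (𝓝 ‖w‖)) : Tendsto u l (𝓝 w) := by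
  rw [tendsto_iff_norm_sub_tendsto_zero]
  have h : Tendsto (fun i => ‖u i - w‖ ^ 2) l (𝓝 0) := by
    have := ((hnorm.pow 2).sub (hw.const_mul 2)).add_const (‖w‖ ^ 2)
    simp only [← norm_sub_sq_real] at this
    simpa using this
  simpa [Real.sqrt_sq] using h.sqrt

end WeakLimits

section Tcrit

variable {H : Type*} [NormedAddCommGroup H] [InnerProductSpace ℝ H] {V : H →L[ℝ] H}
  {β : H} {α : ℝ}

/-- The Cauchy-Schwarz inequality for the form `⟪x, V y⟫`. -/
theorem inner_map_sq_le (hsa : ∀ x y : H, ⟪V x, y⟫ = ⟪x, V y⟫)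
    (hpos : ∀ x : H, 0 ≤ ⟪x, V x⟫) (x y : H) :
    ⟪x, V y⟫ ^ 2 ≤ ⟪x, V x⟫ * ⟪y, V y⟫ := by
  have h := discrim_le_zero (a := ⟪y, V y⟫) (b := 2 * ⟪x, V y⟫) (c := ⟪x, V x⟫) fun t => by
    have := hpos (x + t • y)
    simp only [map_add, map_smul, inner_add_left, inner_add_right, real_inner_smul_left,
      real_inner_smul_right] at this
    rw [← hsa y x, real_inner_comm x (V y)] at this
    linarith
  unfold discrim at h
  linarith

theorem Tcrit_neg (w : H) : Tcrit V β α (-w) = Tcrit V β α w := by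
  simp [Tcrit]

theorem Tcrit_nonneg (w : H) : 0 ≤ Tcrit V β α w := by
  unfold Tcrit
  split_ifs <;> positivity

theorem Tcrit_le (hsa : ∀ x y : H, ⟪V x, y⟫ = ⟪x, V y⟫) (hpos : ∀ x : H, 0 ≤ ⟪x, V x⟫) (w : H) :
    Tcrit V β α w ≤ ⟪β, V β⟫ * ⟪w, V w⟫ ^ (α / (1 - α)) := by
  unfold Tcrit
  split_ifs with h
  · calc ⟪β, V w⟫ ^ 2 * ⟪w, V w⟫ ^ (α / (1 - α) - 1)
        ≤ ⟪β, V β⟫ * ⟪w, V w⟫ * ⟪w, V w⟫ ^ (α / (1 - α) - 1) := by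
          gcongr
          exact inner_map_sq_le hsa hpos β w
      _ = ⟪β, V β⟫ * ⟪w, V w⟫ ^ (α / (1 - α)) := by
          rw [Real.rpow_sub_one h.ne']
          field_simp
  · exact mul_nonneg (hpos β) (Real.rpow_nonneg (hpos w) _)

/-- `Tcrit` is homogeneous of degree `2 α / (1 - α)`. -/
theorem Tcrit_smul {c : ℝ} (hc : 0 < c) (w : H) :
    Tcrit V β α (c • w) = (c ^ 2) ^ (α / (1 - α)) * Tcrit V β α w := by
  have hq : ⟪c • w, V (c • w)⟫ = c ^ 2 * ⟪w, V w⟫ := by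
    simp only [map_smul, real_inner_smul_left, real_inner_smul_right]
    ring
  have hc2 : 0 < c ^ 2 := by positivity
  unfold Tcrit
  rw [hq]
  simp only [mul_pos_iff_of_pos_left hc2]
  split_ifs with h
  · rw [Real.mul_rpow hc2.le h.le, Real.rpow_sub_one hc2.ne', map_smul, real_inner_smul_right]
    field_simp
  · simp

/-- `Tcrit` is continuous with respect to joint convergence of `V w` and `⟪w, V w⟫`. -/
theorem tendsto_Tcrit {ι : Type*} {l : Filter ι} (hsa : ∀ x y : H, ⟪V x, y⟫ = ⟪x, V y⟫)
    (hpos : ∀ x : H, 0 ≤ ⟪x, V x⟫) (hα : 0 < α / (1 - α)) {u : ι → H} {w : H}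
    (hV : Tendsto (fun i => V (u i)) l (𝓝 (V w)))
    (hq : Tendsto (fun i => ⟪u i, V (u i)⟫) l (𝓝 ⟪w, V w⟫)) :
    Tendsto (fun i => Tcrit V β α (u i)) l (𝓝 (Tcrit V β α w)) := by
  by_cases h : 0 < ⟪w, V w⟫
  · have hlim := (((tendsto_const_nhds (x := β)).inner hV).pow 2).mul
      (hq.rpow_const (p := α / (1 - α) - 1) (Or.inl h.ne'))
    have hw : Tcrit V β α w = ⟪β, V w⟫ ^ 2 * ⟪w, V w⟫ ^ (α / (1 - α) - 1) := if_pos h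
    rw [hw]
    refine hlim.congr' ?_
    filter_upwards [hq.eventually_const_lt h] with i hi
    exact (if_pos hi).symm
  · have hw : Tcrit V β α w = 0 := if_neg h
    have hq0 : ⟪w, V w⟫ = 0 := le_antisymm (not_lt.1 h) (hpos w)
    rw [hw]
    have hlim := (hq.rpow_const (p := α / (1 - α)) (Or.inr hα.le)).const_mul ⟪β, V β⟫
    rw [hq0, Real.zero_rpow hα.ne', mul_zero] at hlim
    exact squeeze_zero (fun i => Tcrit_nonneg _) (fun i => Tcrit_le hsa hpos _) hlim

/-- A maximizer of a positive value over the closed unit ball lies on the unit sphere. -/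
theorem norm_eq_one_of_Tcrit_ge (hα : 0 < α / (1 - α)) {M : ℝ} (hM : 0 < M)
    (hmax : ∀ w : H, ‖w‖ = 1 → Tcrit V β α w ≤ M) {w : H} (hw : ‖w‖ ≤ 1)
    (hMw : M ≤ Tcrit V β α w) : ‖w‖ = 1 := by
  by_contra hne
  have hw0 : w ≠ 0 := by
    rintro rfl
    simp [Tcrit] at hMw
    linarith
  have hpos : 0 < ‖w‖ := norm_pos_iff.2 hw0
  have hinv : 1 < ‖w‖⁻¹ := (one_lt_inv₀ hpos).2 (lt_of_le_of_ne hw hne)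
  have hle := hmax (‖w‖⁻¹ • w) (by rw [norm_smul, norm_inv, norm_norm, inv_mul_cancel₀ hpos.ne'])
  rw [Tcrit_smul (inv_pos.2 hpos)] at hle
  have hgt : 1 < (‖w‖⁻¹ ^ 2) ^ (α / (1 - α)) :=
    Real.one_lt_rpow (one_lt_pow₀ hinv two_ne_zero) hα
  nlinarith

end Tcrit

/-- Values at approximate maximizers converge to the maximum, under uniform convergence. -/
theorem tendsto_apply_maximizer {X : Type*} {S : Set X} {T : X → ℝ} {That : ℕ → X → ℝ}
    (hconv : ∀ ε > (0 : ℝ), ∃ N : ℕ, ∀ n ≥ N, ∀ x ∈ S, |That n x - T x| < ε)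
    {a : X} (ha : a ∈ S) (hmax : ∀ x ∈ S, T x ≤ T a) {u : ℕ → X} (hu : ∀ n, u n ∈ S)
    (humax : ∀ n, ∀ x ∈ S, That n x ≤ That n (u n)) :
    Tendsto (fun n => T (u n)) atTop (𝓝 (T a)) := by
  refine Metric.tendsto_atTop.2 fun ε hε => ?_
  obtain ⟨N, hN⟩ := hconv (ε / 2) (half_pos hε)
  refine ⟨N, fun n hn => ?_⟩
  have h₁ := abs_lt.1 (hN n hn a ha)
  have h₂ := abs_lt.1 (hN n hn (u n) (hu n))
  have h₃ := humax n a ha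
  have h₄ := hmax (u n) (hu n)
  rw [Real.dist_eq, abs_lt]
  constructor <;> linarith

/-- Deterministic core of Theorem 1: consistency of the empirical functional
continuum basis functions. -/
theorem empirical_maximizers_consistent
    {H : Type*} [NormedAddCommGroup H] [InnerProductSpace ℝ H] [CompleteSpace H]
    (V : H →L[ℝ] H) (hcpt : IsCompactOperator V)
    (hsa : ∀ x y : H, ⟪V x, y⟫ = ⟪x, V y⟫)
    (hpos : ∀ x : H, 0 ≤ ⟪x, V x⟫)
    (β : H) (α : ℝ) (hα : α ∈ Set.Ioo (0 : ℝ) 1)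
    (wstar : H) (hnorm : ‖wstar‖ = 1)
    (hTpos : 0 < Tcrit V β α wstar)
    (huniq : ∀ w : H, ‖w‖ = 1 → w ≠ wstar → w ≠ -wstar →
      Tcrit V β α w < Tcrit V β α wstar)
    (That : ℕ → H → ℝ)
    (hconv : ∀ ε > (0 : ℝ), ∃ N : ℕ, ∀ n ≥ N, ∀ w : H, ‖w‖ ≤ 1 →
      |That n w - Tcrit V β α w| < ε)
    (what : ℕ → H) (hwnorm : ∀ n : ℕ, ‖what n‖ = 1)
    (hwmax : ∀ n : ℕ, ∀ w : H, ‖w‖ = 1 → That n w ≤ That n (what n)) :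
    Tendsto (fun n : ℕ => min ‖what n - wstar‖ ‖what n + wstar‖) atTop (nhds 0) := by
  have ha : 0 < α / (1 - α) := div_pos hα.1 (sub_pos.2 hα.2)
  have hmax : ∀ w : H, ‖w‖ = 1 → Tcrit V β α w ≤ Tcrit V β α wstar := by
    intro w hw
    by_cases h₁ : w = wstar
    · rw [h₁]
    by_cases h₂ : w = -wstar
    · rw [h₂, Tcrit_neg]
    exact (huniq w hw h₁ h₂).le
  have hT : Tendsto (fun n => Tcrit V β α (what n)) atTop (𝓝 (Tcrit V β α wstar)) :=
    tendsto_apply_maximizer (S := {w | ‖w‖ = 1})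
      (fun ε hε => (hconv ε hε).imp fun N hN n hn w hw => hN n hn w (le_of_eq hw))
      hnorm hmax hwnorm hwmax
  rw [tendsto_iff_ultrafilter]
  intro U hU
  obtain ⟨w, hw1, hw⟩ := exists_weak_limit_of_norm_le U (fun n => (hwnorm n).le)
  have hV := hcpt.tendsto_of_tendsto_inner hsa (fun n => (hwnorm n).le) hw
  have hq : Tendsto (fun n => ⟪what n, V (what n)⟫) U (𝓝 ⟪w, V w⟫) := by
    have hdiff : Tendsto (fun n => ⟪what n, V (what n) - V w⟫) U (𝓝 0) := by
      refine squeeze_zero_norm (fun n => ?_) (tendsto_iff_norm_sub_tendsto_zero.1 hV)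
      simpa [hwnorm n] using norm_inner_le_norm (𝕜 := ℝ) (what n) (V (what n) - V w)
    simpa [inner_sub_right] using hdiff.add (hw (V w))
  have hTw : Tcrit V β α w = Tcrit V β α wstar :=
    tendsto_nhds_unique (tendsto_Tcrit hsa hpos ha hV hq) (hT.mono_left hU)
  have hwn : ‖w‖ = 1 := norm_eq_one_of_Tcrit_ge ha hTpos hmax hw1 hTw.ge
  have hlim : Tendsto what U (𝓝 w) :=
    tendsto_of_tendsto_inner_of_tendsto_norm (hw w) (by simp [hwnorm, hwn])
  have hmin : min ‖w - wstar‖ ‖w + wstar‖ = 0 := by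
    by_cases h₁ : w = wstar
    · simp [h₁]
    by_cases h₂ : w = -wstar
    · simp [h₂]
    exact absurd hTw (huniq w hwn h₁ h₂).ne
  rw [← hmin]
  exact (hlim.sub_const wstar).norm.min (hlim.add_const wstar).norm
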